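/- Let n = 4, let m ∈ ℝ be a constant, and let L = (1/2)(−p₁² + p₂² + p₃² + p₄² + m²u²) on ℝ⁹. Then E(Lβ) = −β₁∧dp₁ + β₂∧dp₂ + β₃∧dp₃ + β₄∧dp₄ + m²·u·β, and consequently for every smooth φ: ℝ⁴ → ℝ, (j¹φ)*E(Lβ) = (φ₁₁ − φ₂₂ − φ₃₃ − φ₄₄ + m²φ)·β, where φ_{μν} := ∂²φ/∂q^μ∂q^ν. Hence the Klein–Gordon equation φ₁₁ − φ₂₂ − φ₃₃ − φ₄₄ + m²φ = 0 is the Euler–Lagrange equation of the first-order Lagrangian (j¹φ)*L = (1/2)(−φ₁² + φ₂² + φ₃² + φ₄² + m²φ²). -/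

import Mathlib

noncomputable section

namespace MA

/-- Points / tangent vectors of ℝ^m. -/
abbrev Vec (m : ℕ) := Fin m → ℝ

/-- An (unbundled) differential `k`-form on ℝ^m : at each point it eats a
`k`-tuple of tangent vectors and returns a real number. -/
abbrev Form (m k : ℕ) := Vec m → (Fin k → Vec m) → ℝ

/-- `ω` is pointwise an alternating multilinear map, i.e. a genuine exterior form. -/
def IsForm {m k : ℕ} (ω : Form m k) : Prop :=
  ∀ x : Vec m, ∃ a : AlternatingMap ℝ (Vec m) ℝ (Fin k), ∀ v, ω x v = a v

/-- Smoothness of a differential form (smoothness of all coefficients). -/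
def SmoothForm {m k : ℕ} (ω : Form m k) : Prop :=
  ∀ v : Fin k → Vec m, ContDiff ℝ (⊤ : ℕ∞) fun x => ω x v

/-- Multiplication of a form by a scalar function. -/
def fsmul {m k : ℕ} (f : Vec m → ℝ) (ω : Form m k) : Form m k := fun x v => f x * ω x v

/-- Wedge (exterior) product of differential forms. -/
def wedge {m k l : ℕ} (ω : Form m k) (η : Form m l) : Form m (k + l) := fun x v =>
  ((k.factorial * l.factorial : ℕ) : ℝ)⁻¹ *
    ∑ σ : Equiv.Perm (Fin (k + l)),
      ((Equiv.Perm.sign σ : ℤ) : ℝ) *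
        (ω x fun i => v (σ (Fin.castAdd l i))) *
        (η x fun j => v (σ (Fin.natAdd k j)))

/-- Interior product (contraction) of a form with a (constant) vector. -/
def iprod {m : ℕ} (u : Vec m) : ∀ {k : ℕ}, Form m k → Form m (k - 1)
  | 0, _ => 0
  | _ + 1, ω => fun x v => ω x (Fin.cons u v)

/-- Exterior derivative of a differential form (coordinate formula). -/
def exd {m k : ℕ} (ω : Form m k) : Form m (k + 1) := fun x v =>
  ∑ i : Fin (k + 1),
    (-1 : ℝ) ^ (i : ℕ) * fderiv ℝ (fun y => ω y fun j => v (i.succAbove j)) x (v i)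

/-- Change the (propositionally equal) degree of a form. -/
def reindex {m k l : ℕ} (h : k = l) (ω : Form m k) : Form m l :=
  fun x v => ω x fun i => v (Fin.cast h i)

/-- Pullback of a differential form along a map. -/
def pullback {a b k : ℕ} (f : Vec a → Vec b) (ω : Form b k) : Form a k :=
  fun x v => ω (f x) fun i => fderiv ℝ f x (v i)

/-- `i`-th standard basis vector of ℝ^m. -/
def basisVec {m : ℕ} (i : Fin m) : Vec m := Pi.single i 1

/-- The coordinate 1-form `dx^i`. -/
def dx {m : ℕ} (i : Fin m) : Form m 1 := fun _ v => v 0 i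

/-- Partial derivative of a function in the `i`-th coordinate direction. -/
def pd {m : ℕ} (i : Fin m) (f : Vec m → ℝ) : Vec m → ℝ := fun x => fderiv ℝ f x (basisVec i)

/- Jet-space coordinates on J¹ℝⁿ = ℝ^{2n+1} : (q¹,…,qⁿ,u,p₁,…,pₙ). -/

/-- Index of the coordinate `q^μ`. -/
def qIdx {n : ℕ} (μ : Fin n) : Fin (2 * n + 1) := ⟨μ, by have := μ.isLt; omega⟩

/-- Index of the coordinate `u`. -/
def uIdx {n : ℕ} : Fin (2 * n + 1) := ⟨n, by omega⟩

/-- Index of the coordinate `p_μ`. -/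
def pIdx {n : ℕ} (μ : Fin n) : Fin (2 * n + 1) := ⟨n + 1 + μ, by have := μ.isLt; omega⟩

/-- The Reeb field `χ = ∂/∂u` (a constant vector field). -/
def chi {n : ℕ} : Vec (2 * n + 1) := basisVec uIdx

/-- The standard contact form `c = du - Σ p_μ dq^μ` on J¹ℝⁿ. -/
def contact {n : ℕ} : Form (2 * n + 1) 1 := fun x v =>
  v 0 uIdx - ∑ μ : Fin n, x (pIdx μ) * v 0 (qIdx μ)

/-- The symplectic-type 2-form `Ω = dc = Σ dq^μ ∧ dp_μ`. -/
def symp {n : ℕ} : Form (2 * n + 1) 2 := ∑ μ : Fin n, wedge (dx (qIdx μ)) (dx (pIdx μ))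

/-- The bottom operator `⊥ = Σ_μ ∂_{p_μ} ⌟ ∂_{q^μ} ⌟ ·` (zero on forms of degree ≤ 1). -/
def botOp {n k : ℕ} (ω : Form (2 * n + 1) k) : Form (2 * n + 1) (k - 2) :=
  ∑ μ : Fin n, iprod (basisVec (pIdx μ)) (iprod (basisVec (qIdx μ)) ω)

/-- A form is effective if it is killed by `χ ⌟ ·` and by `⊥`. -/
def Effective {n k : ℕ} (ω : Form (2 * n + 1) k) : Prop :=
  iprod (chi (n := n)) ω = 0 ∧ botOp ω = 0

/-- The projection `p(α) = α - c ∧ (χ ⌟ α)` onto forms annihilated by `χ ⌟ ·`. -/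
def proj {n : ℕ} : ∀ {k : ℕ}, Form (2 * n + 1) k → Form (2 * n + 1) k
  | 0, α => α
  | j + 1, α => α - reindex (Nat.add_comm 1 j) (wedge contact (iprod (chi (n := n)) α))

/-- The projected exterior derivative `d_p = p ∘ d`. -/
def dproj {n k : ℕ} (ω : Form (2 * n + 1) k) : Form (2 * n + 1) (k + 1) := proj (exd ω)

/-- Lie derivative along the (constant) Reeb field `χ`. -/
def lieChi {n k : ℕ} (ω : Form (2 * n + 1) k) : Form (2 * n + 1) k := fun x v =>
  fderiv ℝ (fun y => ω y v) x (chi (n := n))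

/-- The Euler operator `E = d_p ∘ ⊥ ∘ d_p + L_χ` on n-forms over J¹ℝⁿ. -/
def euler : ∀ {n : ℕ}, Form (2 * n + 1) n → Form (2 * n + 1) n
  | 0, ω => lieChi ω
  | n + 1, ω =>
    reindex (show n + 1 + 1 - 2 + 1 = n + 1 by omega) (dproj (botOp (dproj ω))) + lieChi ω

/-- The horizontal volume form `β = dq¹ ∧ … ∧ dqⁿ` on J¹ℝⁿ. -/
def qvol {n : ℕ} : Form (2 * n + 1) n := fun _ v =>
  Matrix.det (Matrix.of fun i j : Fin n => v i (qIdx j))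

/-- The volume form `β = dq¹ ∧ … ∧ dqⁿ` on the base ℝⁿ. -/
def baseVol {n : ℕ} : Form n n := fun _ v => Matrix.det (Matrix.of fun i j : Fin n => v i j)

/-- `β_μ = ∂_{q^μ} ⌟ β`. -/
def betaMu {n : ℕ} (μ : Fin n) : Form (2 * n + 1) (n - 1) := iprod (basisVec (qIdx μ)) qvol

/-- The first jet prolongation `j¹φ : ℝⁿ → ℝ^{2n+1}`, `x ↦ (x, φ(x), ∂₁φ(x), …, ∂ₙφ(x))`. -/
def jet {n : ℕ} (φ : Vec n → ℝ) (x : Vec n) : Vec (2 * n + 1) := fun i =>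
  if h : (i : ℕ) < n then x ⟨i, h⟩
  else if h2 : (i : ℕ) = n then φ x
  else fderiv ℝ φ x (basisVec ⟨(i : ℕ) - (n + 1), by have := i.isLt; omega⟩)

/-- Second partial derivative `φ_{μν} = ∂²φ/∂q^μ∂q^ν`. -/
def d2 {n : ℕ} (φ : Vec n → ℝ) (μ ν : Fin n) : Vec n → ℝ := fun x =>
  fderiv ℝ (fun y => fderiv ℝ φ y (basisVec ν)) x (basisVec μ)

/-- A form is multisymplectic if it is closed and pointwise nondegenerate. -/
def Multisymplectic {m k : ℕ} (μ : Form m k) : Prop :=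
  exd μ = 0 ∧ ∀ (x v : Vec m), iprod v μ x = 0 → v = 0

/-- Lift a form on J¹ℝⁿ = ℝ^{2n+1} to ℝ^{2n+2} = J¹ℝⁿ × ℝ (extra coordinate `e`)
along the projection. -/
def liftForm {n k : ℕ} (ω : Form (2 * n + 1) k) : Form (2 * n + 1 + 1) k :=
  pullback (fun y (i : Fin (2 * n + 1)) => y i.castSucc) ω

/-- The 1-form `de` on ℝ^{2n+2}. -/
def deForm {n : ℕ} : Form (2 * n + 1 + 1) 1 := dx (Fin.last (2 * n + 1))

/-- The (n+1)-form `m_ω = de ∧ β + c ∧ ω` on ℝ^{2n+2}. -/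
def msf {n : ℕ} (ω : Form (2 * n + 1) n) : Form (2 * n + 1 + 1) (n + 1) :=
  reindex (Nat.add_comm 1 n) (wedge (deForm (n := n)) (liftForm qvol)) +
    reindex (Nat.add_comm 1 n) (wedge (liftForm (contact (n := n))) (liftForm ω))

/-- The Klein–Gordon Lagrangian `L = (1/2)(−p₁² + p₂² + p₃² + p₄² + m²u²)` on ℝ⁹. -/
def lagKG (m0 : ℝ) : Vec (2 * 4 + 1) → ℝ := fun x =>
  (1 / 2 : ℝ) * (-(x (pIdx (0 : Fin 4))) ^ 2 + (x (pIdx (1 : Fin 4))) ^ 2 +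
    (x (pIdx (2 : Fin 4))) ^ 2 + (x (pIdx (3 : Fin 4))) ^ 2 + m0 ^ 2 * (x (uIdx (n := 4))) ^ 2)

/-- The alternating sum `∑ i, (-1)^i a(v_i) η(v_0, …, v̂_i, …, v_k)`, i.e. the value at `v` of the
exterior product of the covector `a` with `η`. -/
def covectorWedge {V : Type*} {k : ℕ} (a : V → ℝ) (η : (Fin k → V) → ℝ) (v : Fin (k + 1) → V) : ℝ :=
  ∑ i : Fin (k + 1), (-1 : ℝ) ^ (i : ℕ) * a (v i) * η fun j => v (i.succAbove j)

section Wedge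

open Equiv

lemma sum_perm_decomposeFin {V : Type*} [AddCommGroup V] [Module ℝ V] {k : ℕ} (a : V → ℝ) (η : AlternatingMap ℝ V ℝ (Fin k))
    (v : Fin (k + 1) → V) (p : Fin (k + 1)) (e : Perm (Fin k)) :
    ((Perm.sign (Perm.decomposeFin.symm (p, e)) : ℤ) : ℝ) *
        a (v (Perm.decomposeFin.symm (p, e) 0)) *
        η (fun j => v (Perm.decomposeFin.symm (p, e) j.succ)) =
      (-1 : ℝ) ^ (p : ℕ) * a (v p) * η fun j => v (p.succAbove j) := by
  have hsq (σ : Perm (Fin k)) : ((Perm.sign σ : ℤ) : ℝ) * ((Perm.sign σ : ℤ) : ℝ) = 1 := by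
    rw [← Int.cast_mul, Int.units_coe_mul_self, Int.cast_one]
  have hperm (w : Fin k → V) (σ : Perm (Fin k)) :
      η (fun j => w (σ j)) = ((Perm.sign σ : ℤ) : ℝ) * η w := by
    have := η.map_perm w σ
    rw [Units.smul_def, zsmul_eq_mul] at this
    exact this
  rw [Perm.decomposeFin.symm_sign, Perm.decomposeFin_symm_apply_zero]
  simp only [Perm.decomposeFin_symm_apply_succ]
  cases p using Fin.cases with
  | zero =>
    simp only [swap_self, refl_apply, Fin.succAbove_zero, if_true, one_mul, Fin.val_zero, pow_zero]
    rw [hperm (fun j => v j.succ) e]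
    linear_combination a (v 0) * η (fun j => v j.succ) * hsq e
  | succ i =>
    simp only [← Fin.succAbove_cycleRange]
    rw [hperm (fun j => v (i.succ.succAbove (i.cycleRange j))) e,
      hperm (fun j => v (i.succ.succAbove j)) i.cycleRange, Fin.sign_cycleRange,
      if_neg (Fin.succ_ne_zero i), Fin.val_succ, pow_succ]
    push_cast
    linear_combination -(-1 : ℝ) ^ (i : ℕ) * a (v i.succ) *
      η (fun j => v (i.succ.succAbove j)) * hsq e

lemma sum_perm_eq_covectorWedge {V : Type*} [AddCommGroup V] [Module ℝ V] {k : ℕ} (a : V → ℝ) (η : AlternatingMap ℝ V ℝ (Fin k))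
    (v : Fin (k + 1) → V) :
    ∑ σ : Perm (Fin (k + 1)), ((Perm.sign σ : ℤ) : ℝ) * a (v (σ 0)) *
      η (fun j => v (σ j.succ)) = k.factorial * covectorWedge a η v := by
  rw [Finset.univ_perm_fin_succ, ← Finset.univ_product_univ]
  simp only [Finset.sum_map, Equiv.toEmbedding_apply, Finset.sum_product, sum_perm_decomposeFin]
  simp [covectorWedge, Finset.mul_sum, Fintype.card_perm]

lemma reindex_wedge_apply {m k : ℕ} (ω : Form m 1) (η : Form m k) (x : Vec m)
    (b : AlternatingMap ℝ (Vec m) ℝ (Fin k)) (hb : ∀ w, η x w = b w) (v : Fin (k + 1) → Vec m) :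
    reindex (Nat.add_comm 1 k) (wedge ω η) x v = covectorWedge (fun w => ω x fun _ => w) b v := by
  have h := sum_perm_eq_covectorWedge (fun w => ω x fun _ => w) b v
  rw [← (finCongr (Nat.add_comm 1 k)).permCongr.sum_comp] at h
  simp only [reindex, wedge, hb]
  rw [inv_mul_eq_iff_eq_mul₀ (by positivity)]
  simp only [Nat.factorial_one, one_mul]
  rw [← h]
  refine Finset.sum_congr rfl fun σ _ => ?_
  rw [Perm.sign_permCongr]
  congr 2
  · congr 2
    funext i
    rw [Subsingleton.elim i 0]
    rfl
  · funext j
    simp only [permCongr_apply, finCongr_apply, finCongr_symm]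
    congr 4
    ext
    simp [Nat.add_comm]

lemma wedge_covector_apply {m k : ℕ} (η : Form m k) (ω : Form m 1) (x : Vec m)
    (b : AlternatingMap ℝ (Vec m) ℝ (Fin k)) (hb : ∀ w, η x w = b w) (v : Fin (k + 1) → Vec m) :
    wedge η ω x v = (-1 : ℝ) ^ k * covectorWedge (fun w => ω x fun _ => w) b v := by
  have h := sum_perm_eq_covectorWedge (fun w => ω x fun _ => w) b v
  simp only [wedge, hb]
  rw [inv_mul_eq_iff_eq_mul₀ (by positivity)]
  simp only [Nat.factorial_one, mul_one]
  rw [mul_left_comm, ← h, ← Equiv.sum_comp (Equiv.mulRight (finRotate (k + 1))), Finset.mul_sum]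
  refine Finset.sum_congr rfl fun σ _ => ?_
  have h0 : ∀ j : Fin 1, finRotate (k + 1) (Fin.natAdd k j) = 0 := fun j => by
    rw [Subsingleton.elim j 0]
    exact finRotate_last
  have h1 : ∀ i : Fin k, finRotate (k + 1) (Fin.castAdd 1 i) = i.succ := fun i => by
    rw [finRotate_apply]
    exact Fin.coeSucc_eq_succ
  simp only [Equiv.coe_mulRight, Perm.mul_apply, h0, h1, Perm.sign_mul, sign_finRotate]
  push_cast [Nat.add_sub_cancel]
  ring

end Wedge

/-- The translation-invariant form with value `η`. -/
def constForm {m k : ℕ} (η : AlternatingMap ℝ (Vec m) ℝ (Fin k)) : Form m k := fun _ v => η v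

/-- The covector `d_p f = df - (∂_u f) c`. -/
def dprojFun {n : ℕ} (f : Vec (2 * n + 1) → ℝ) (x w : Vec (2 * n + 1)) : ℝ :=
  fderiv ℝ f x w - fderiv ℝ f x (chi (n := n)) * contact x fun _ : Fin 1 => w

section Dproj

variable {m k : ℕ} {ι : Type*} [Fintype ι]

lemma sum_smul_alternatingMap_apply (c : ι → ℝ) (η : ι → AlternatingMap ℝ (Vec m) ℝ (Fin k))
    (w : Fin k → Vec m) : (∑ μ, c μ • η μ) w = ∑ μ, c μ * η μ w := by
  let ev : AlternatingMap ℝ (Vec m) ℝ (Fin k) →+ ℝ :=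
    { toFun := fun ω => ω w, map_zero' := rfl, map_add' := fun _ _ => rfl }
  exact map_sum ev _ _

lemma exd_sum_fsmul_constForm (f : ι → Vec m → ℝ) (hf : ∀ μ, Differentiable ℝ (f μ))
    (η : ι → AlternatingMap ℝ (Vec m) ℝ (Fin k)) (x : Vec m) (v : Fin (k + 1) → Vec m) :
    exd (∑ μ, fsmul (f μ) (constForm (η μ))) x v =
      ∑ μ, covectorWedge (fderiv ℝ (f μ) x) (η μ) v := by
  have key (w : Fin k → Vec m) (u : Vec m) :
      fderiv ℝ (fun y => (∑ μ, fsmul (f μ) (constForm (η μ))) y w) x u =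
        ∑ μ, fderiv ℝ (f μ) x u * η μ w := by
    simp only [Finset.sum_apply, fsmul, constForm]
    rw [fderiv_fun_sum fun μ _ => ((hf μ) x).mul_const _, _root_.sum_apply]
    refine Finset.sum_congr rfl fun μ _ => ?_
    rw [fderiv_mul_const ((hf μ) x), _root_.smul_apply, smul_eq_mul, mul_comm]
  simp only [exd, covectorWedge, key, Finset.mul_sum]
  rw [Finset.sum_comm]
  simp only [mul_assoc]

lemma covectorWedge_cons (a : Vec m → ℝ) (η : AlternatingMap ℝ (Vec m) ℝ (Fin k)) (u : Vec m)
    (hη : ∀ w, (∃ i, w i = u) → η w = 0) (w : Fin k → Vec m) :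
    covectorWedge a η (Fin.cons u w) = a u * η w := by
  rw [covectorWedge, Fin.sum_univ_succ, Finset.sum_eq_zero]
  · simp
  · intro i _
    rw [hη, mul_zero]
    cases k with
    | zero => exact i.elim0
    | succ k => exact ⟨0, by simp⟩

lemma dproj_sum_fsmul_constForm {n : ℕ} (f : ι → Vec (2 * n + 1) → ℝ)
    (hf : ∀ μ, Differentiable ℝ (f μ))
    (η : ι → AlternatingMap ℝ (Vec (2 * n + 1)) ℝ (Fin k))
    (hη : ∀ μ w, (∃ i, w i = chi (n := n)) → η μ w = 0)
    (x : Vec (2 * n + 1)) (v : Fin (k + 1) → Vec (2 * n + 1)) :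
    dproj (∑ μ, fsmul (f μ) (constForm (η μ))) x v =
      ∑ μ, covectorWedge (dprojFun (f μ) x) (η μ) v := by
  have hb (w : Fin k → Vec (2 * n + 1)) :
      iprod (chi (n := n)) (exd (∑ μ, fsmul (f μ) (constForm (η μ)))) x w =
        (∑ μ, fderiv ℝ (f μ) x (chi (n := n)) • η μ) w := by
    simp only [iprod, exd_sum_fsmul_constForm f hf, sum_smul_alternatingMap_apply]
    exact Finset.sum_congr rfl fun μ _ => covectorWedge_cons _ _ _ (hη μ) w
  have hsub : dproj (∑ μ, fsmul (f μ) (constForm (η μ))) x v =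
      exd (∑ μ, fsmul (f μ) (constForm (η μ))) x v -
        reindex (Nat.add_comm 1 k) (wedge contact
          (iprod (chi (n := n)) (exd (∑ μ, fsmul (f μ) (constForm (η μ)))))) x v := rfl
  rw [hsub, exd_sum_fsmul_constForm f hf, reindex_wedge_apply _ _ _ _ hb]
  simp only [covectorWedge, dprojFun, sum_smul_alternatingMap_apply, Finset.mul_sum]
  rw [Finset.sum_comm (s := (Finset.univ : Finset (Fin (k + 1)))), ← Finset.sum_sub_distrib]
  refine Finset.sum_congr rfl fun μ _ => ?_
  rw [← Finset.sum_sub_distrib]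
  exact Finset.sum_congr rfl fun i _ => by ring

end Dproj

section Vol

lemma qIdx_injective {n : ℕ} : Function.Injective (qIdx (n := n)) := fun μ ν h => by
  simpa [qIdx, Fin.ext_iff] using h

lemma qIdx_ne_pIdx {n : ℕ} (μ ν : Fin n) : qIdx μ ≠ pIdx ν := by
  simp only [qIdx, pIdx, ne_eq, Fin.mk.injEq]
  omega

lemma qIdx_ne_uIdx {n : ℕ} (μ : Fin n) : qIdx μ ≠ uIdx := by
  simp only [qIdx, uIdx, ne_eq, Fin.mk.injEq]
  omega

lemma pIdx_ne_uIdx {n : ℕ} (μ : Fin n) : pIdx μ ≠ uIdx := by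
  simp only [pIdx, uIdx, ne_eq, Fin.mk.injEq]
  omega

/-- The value of the horizontal volume form as an alternating map. -/
def qvolAlt (n : ℕ) : AlternatingMap ℝ (Vec (2 * n + 1)) ℝ (Fin n) :=
  Matrix.detRowAlternating.compLinearMap (LinearMap.funLeft ℝ ℝ qIdx)

lemma qvol_eq_constForm {n : ℕ} : qvol (n := n) = constForm (qvolAlt n) := rfl

lemma qvolAlt_eq_zero {n : ℕ} {w : Fin n → Vec (2 * n + 1)} (i : Fin n)
    (h : ∀ μ, w i (qIdx μ) = 0) : qvolAlt n w = 0 :=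
  (Matrix.detRowAlternating (R := ℝ) (n := Fin n)).map_coord_zero i (funext h)

lemma chi_qIdx {n : ℕ} (μ : Fin n) : chi (n := n) (qIdx μ) = 0 :=
  Pi.single_eq_of_ne (qIdx_ne_uIdx μ) _

lemma basisVec_pIdx_qIdx {n : ℕ} (ν μ : Fin n) : basisVec (pIdx ν) (qIdx μ) = 0 :=
  Pi.single_eq_of_ne (qIdx_ne_pIdx μ ν) _

/-- The value of `β_μ` as an alternating map. -/
def betaAlt {n : ℕ} (μ : Fin (n + 1)) :
    AlternatingMap ℝ (Vec (2 * (n + 1) + 1)) ℝ (Fin n) :=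
  (qvolAlt (n + 1)).curryLeft (basisVec (qIdx μ))

lemma betaAlt_apply {n : ℕ} (μ : Fin (n + 1)) (w : Fin n → Vec (2 * (n + 1) + 1)) :
    betaAlt μ w = qvolAlt (n + 1) (Fin.cons (basisVec (qIdx μ)) w) := rfl

lemma qvolAlt_chi {n : ℕ} (w : Fin n → Vec (2 * n + 1)) :
    (∃ i, w i = chi (n := n)) → qvolAlt n w = 0 := fun ⟨i, hi⟩ =>
  qvolAlt_eq_zero i fun μ => by rw [hi, chi_qIdx]

lemma betaAlt_chi {n : ℕ} (μ : Fin (n + 1)) (w : Fin n → Vec (2 * (n + 1) + 1)) :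
    (∃ i, w i = chi (n := n + 1)) → betaAlt μ w = 0 := fun ⟨i, hi⟩ =>
  qvolAlt_chi _ ⟨i.succ, by simpa using hi⟩

end Vol

lemma contact_basisVec_pIdx {n : ℕ} (x : Vec (2 * n + 1)) (μ : Fin n) :
    contact x (fun _ : Fin 1 => basisVec (pIdx μ)) = 0 := by
  have hu : basisVec (pIdx μ) uIdx = (0 : ℝ) := Pi.single_eq_of_ne (pIdx_ne_uIdx μ).symm _
  simp [contact, basisVec_pIdx_qIdx, hu]

lemma botOp_apply {n k : ℕ} (ω : Form (2 * n + 1) (k + 2)) (x : Vec (2 * n + 1))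
    (v : Fin k → Vec (2 * n + 1)) :
    botOp ω x v =
      ∑ μ, ω x (Fin.cons (basisVec (qIdx μ)) (Fin.cons (basisVec (pIdx μ)) v)) := by
  simp only [botOp]
  erw [Finset.sum_apply, Finset.sum_apply]
  rfl

lemma covectorWedge_qvolAlt_cons_cons {n : ℕ} (a : Vec (2 * (n + 1) + 1) → ℝ) (μ : Fin (n + 1))
    (v : Fin n → Vec (2 * (n + 1) + 1)) :
    covectorWedge a (qvolAlt (n + 1))
      (Fin.cons (basisVec (qIdx μ)) (Fin.cons (basisVec (pIdx μ)) v)) =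
      -(a (basisVec (pIdx μ)) * betaAlt μ v) := by
  rw [covectorWedge, Fin.sum_univ_succ, Fin.sum_univ_succ, Finset.sum_eq_zero]
  · rw [qvolAlt_eq_zero (w := fun j => (Fin.cons (basisVec (qIdx μ))
      (Fin.cons (basisVec (pIdx μ)) v) : Fin (n + 2) → _) (Fin.succAbove 0 j)) 0
      (by simp [basisVec_pIdx_qIdx]), betaAlt_apply]
    have : (fun j => (Fin.cons (basisVec (qIdx μ)) (Fin.cons (basisVec (pIdx μ)) v) :
        Fin (n + 2) → Vec (2 * (n + 1) + 1)) ((Fin.succ 0).succAbove j)) =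
        (Fin.cons (basisVec (qIdx μ)) v : Fin (n + 1) → Vec (2 * (n + 1) + 1)) := by
      funext j
      cases j using Fin.cases <;> simp
    rw [this]
    simp
  · intro i _
    cases n with
    | zero => exact i.elim0
    | succ n =>
      rw [qvolAlt_eq_zero 1, mul_zero]
      intro ν
      have : i.succ.succ.succAbove (1 : Fin (n + 1 + 1)) = Fin.succ 0 := by
        rw [← Fin.succ_zero_eq_one, Fin.succ_succAbove_succ, Fin.succ_succAbove_zero]
      rw [this, Fin.cons_succ, Fin.cons_zero, basisVec_pIdx_qIdx]

lemma dproj_fsmul_qvol {n : ℕ} {L : Vec (2 * n + 1) → ℝ} (hL : Differentiable ℝ L)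
    (x : Vec (2 * n + 1)) (v : Fin (n + 1) → Vec (2 * n + 1)) :
    dproj (fsmul L qvol) x v = covectorWedge (dprojFun L x) (qvolAlt n) v := by
  simpa [qvol_eq_constForm] using dproj_sum_fsmul_constForm (ι := Unit) (fun _ => L)
    (fun _ => hL) (fun _ => qvolAlt n) (fun _ => qvolAlt_chi) x v

lemma botOp_dproj_fsmul_qvol {n : ℕ} {L : Vec (2 * (n + 1) + 1) → ℝ} (hL : Differentiable ℝ L) :
    (botOp (dproj (fsmul L qvol)) : Form (2 * (n + 1) + 1) n) =
      ∑ μ, fsmul (-pd (pIdx μ) L) (constForm (betaAlt μ)) := by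
  funext x v
  refine (botOp_apply _ x v).trans ?_
  simp only [dproj_fsmul_qvol hL, covectorWedge_qvolAlt_cons_cons, Finset.sum_apply, fsmul,
    constForm, dprojFun, contact_basisVec_pIdx, pd, Pi.neg_apply]
  exact Finset.sum_congr rfl fun μ _ => by ring

/-- The Euler operator on a first-order Lagrangian form `Lβ`. -/
lemma euler_fsmul_qvol {n : ℕ} {L : Vec (2 * (n + 1) + 1) → ℝ} (hL : Differentiable ℝ L)
    (hL' : ∀ μ, Differentiable ℝ (pd (pIdx μ) L)) (x : Vec (2 * (n + 1) + 1))
    (v : Fin (n + 1) → Vec (2 * (n + 1) + 1)) :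
    euler (fsmul L qvol) x v =
      ∑ μ, covectorWedge (dprojFun (-pd (pIdx μ) L) x) (betaAlt μ) v +
        pd uIdx L x * qvol x v := by
  have h1 : euler (fsmul L qvol) x v =
      dproj (botOp (dproj (fsmul L qvol)) : Form (2 * (n + 1) + 1) n) x v +
        lieChi (fsmul L qvol) x v := rfl
  rw [h1, botOp_dproj_fsmul_qvol hL, dproj_sum_fsmul_constForm _ (fun μ => (hL' μ).neg) _
    betaAlt_chi]
  congr 1
  simp only [lieChi, fsmul, qvol_eq_constForm, constForm, pd, chi]
  rw [fderiv_mul_const (hL x), _root_.smul_apply, smul_eq_mul, mul_comm]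

/-- Cramer's rule: on `ℝⁿ⁺¹`, `a ∧ (e_μ ⌟ vol) = a(e_μ) vol`. -/
lemma covectorWedge_det_cons {n : ℕ} (a : Vec (n + 1) →ₗ[ℝ] ℝ) (μ : Fin (n + 1))
    (v : Fin (n + 1) → Vec (n + 1)) :
    covectorWedge a (fun w : Fin n → Vec (n + 1) =>
      Matrix.det (Matrix.of (Fin.cons (basisVec μ) w : Fin (n + 1) → Vec (n + 1)))) v =
      a (basisVec μ) * Matrix.det (Matrix.of v) := by
  have hterm (i : Fin (n + 1)) : (-1 : ℝ) ^ (i : ℕ) *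
      Matrix.det (Matrix.of (Fin.cons (basisVec μ) (fun j => v (i.succAbove j)) :
        Fin (n + 1) → Vec (n + 1))) = (Matrix.of v).adjugate μ i := by
    rw [Matrix.adjugate_apply]
    have h := (Matrix.detRowAlternating (R := ℝ) (n := Fin (n + 1))).map_insertNth i
      (basisVec μ) (fun j => v (i.succAbove j))
    refine Eq.trans ?_ (h.symm.trans ?_)
    · rw [zsmul_eq_mul]
      push_cast
      rfl
    congr 1
    exact (Fin.insertNth_removeNth i (basisVec μ) v)
  have hvec : ∑ i, (Matrix.of v).adjugate μ i • v i = Matrix.det (Matrix.of v) • basisVec μ := by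
    funext ν
    have h := congrFun (congrFun (Matrix.adjugate_mul (Matrix.of v)) μ) ν
    rw [Matrix.mul_apply] at h
    simpa [basisVec, Pi.single_apply, Matrix.one_apply, eq_comm] using h
  calc _ = ∑ i, (Matrix.of v).adjugate μ i * a (v i) :=
        Finset.sum_congr rfl fun i _ => by rw [← hterm]; ring
    _ = a (∑ i, (Matrix.of v).adjugate μ i • v i) := by simp
    _ = _ := by rw [hvec, map_smul, smul_eq_mul, mul_comm]

section Jet

variable {n : ℕ} (φ : Vec n → ℝ) (x : Vec n)

lemma jet_qIdx (μ : Fin n) : jet φ x (qIdx μ) = x μ := by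
  simp [jet, qIdx]

lemma jet_uIdx : jet φ x uIdx = φ x := by
  simp [jet, uIdx]

lemma jet_pIdx (μ : Fin n) : jet φ x (pIdx μ) = fderiv ℝ φ x (basisVec μ) := by
  have h1 : ¬ n + 1 + (μ : ℕ) < n := by omega
  have h2 : ¬ n + 1 + (μ : ℕ) = n := by omega
  simp [jet, pIdx, h1, h2]

variable {φ}

lemma differentiable_fderiv_apply (hφ : ContDiff ℝ (⊤ : ℕ∞) φ) (w : Vec n) :
    Differentiable ℝ fun y => fderiv ℝ φ y w :=
  ((hφ.fderiv_right (m := 1) (by norm_cast)).differentiable (by norm_num)).clm_apply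
    (differentiable_const w)

lemma differentiable_jet (hφ : ContDiff ℝ (⊤ : ℕ∞) φ) : Differentiable ℝ (jet φ) := by
  rw [differentiable_pi]
  intro i
  unfold jet
  split_ifs
  · fun_prop
  · exact hφ.differentiable (by simp)
  · exact differentiable_fderiv_apply hφ _

lemma fderiv_jet_apply (hφ : ContDiff ℝ (⊤ : ℕ∞) φ) (w : Vec n) (i : Fin (2 * n + 1)) :
    fderiv ℝ (jet φ) x w i = fderiv ℝ (fun y => jet φ y i) x w := by
  rw [fderiv_apply (differentiable_jet hφ x)]
  rfl

lemma fderiv_jet_qIdx (hφ : ContDiff ℝ (⊤ : ℕ∞) φ) (w : Vec n) (μ : Fin n) :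
    fderiv ℝ (jet φ) x w (qIdx μ) = w μ := by
  rw [fderiv_jet_apply x hφ]
  simp only [jet_qIdx]
  rw [fderiv_apply differentiableAt_id]
  simp

lemma fderiv_jet_pIdx (hφ : ContDiff ℝ (⊤ : ℕ∞) φ) (w : Vec n) (μ : Fin n) :
    fderiv ℝ (jet φ) x w (pIdx μ) = fderiv ℝ (fun y => fderiv ℝ φ y (basisVec μ)) x w := by
  rw [fderiv_jet_apply x hφ]
  simp only [jet_pIdx]

lemma pullback_jet_qvol (hφ : ContDiff ℝ (⊤ : ℕ∞) φ) : pullback (jet φ) qvol = baseVol := by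
  funext x v
  simp only [pullback, qvol, baseVol, fderiv_jet_qIdx x hφ]

end Jet

/-- On prolongations, `dp_μ ∧ β_μ` restricts to `φ_{μμ} β`. -/
lemma pullback_jet_betaMu_wedge {n : ℕ} {φ : Vec (n + 1) → ℝ} (hφ : ContDiff ℝ (⊤ : ℕ∞) φ)
    (μ : Fin (n + 1)) (x : Vec (n + 1)) (v : Fin (n + 1) → Vec (n + 1)) :
    pullback (jet φ) (wedge (betaMu μ) (dx (pIdx μ)) : Form (2 * (n + 1) + 1) (n + 1)) x v =
      (-1) ^ n * (d2 φ μ μ x * baseVol x v) := by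
  have hw := wedge_covector_apply (betaMu μ) (dx (pIdx μ)) (jet φ x) (betaAlt μ) (fun _ => rfl)
    (fun i => fderiv ℝ (jet φ) x (v i))
  refine hw.trans ?_
  congr 1
  refine Eq.trans ?_ (covectorWedge_det_cons
    (fderiv ℝ (fun y => fderiv ℝ φ y (basisVec μ)) x).toLinearMap μ v)
  simp only [covectorWedge, dx, fderiv_jet_pIdx x hφ]
  refine Finset.sum_congr rfl fun i _ => ?_
  congr 1
  refine congrArg Matrix.det ?_
  ext j ν
  cases j using Fin.cases with
  | zero => simp [LinearMap.funLeft_apply, basisVec, Pi.single_apply, qIdx_injective.eq_iff]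
  | succ j => simp [LinearMap.funLeft_apply, fderiv_jet_qIdx x hφ]

lemma covectorWedge_const_mul {V : Type*} {k : ℕ} (c : ℝ) (a : V → ℝ) (η : (Fin k → V) → ℝ)
    (v : Fin (k + 1) → V) :
    covectorWedge (fun w => c * a w) η v = c * covectorWedge a η v := by
  simp only [covectorWedge, Finset.mul_sum]
  exact Finset.sum_congr rfl fun i _ => by ring

lemma dprojFun_const_mul_pIdx {n : ℕ} (c : ℝ) (μ : Fin n) (x : Vec (2 * n + 1)) :
    dprojFun (fun y => c * y (pIdx μ)) x = fun w => c * w (pIdx μ) := by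
  have h : HasFDerivAt (fun y : Vec (2 * n + 1) => c * y (pIdx μ))
      (c • ContinuousLinearMap.proj (R := ℝ) (φ := fun _ => ℝ) (pIdx μ)) x :=
    (hasFDerivAt_apply (pIdx μ) x).const_mul c
  have hchi : chi (n := n) (pIdx μ) = 0 := Pi.single_eq_of_ne (pIdx_ne_uIdx μ) _
  funext w
  simp [dprojFun, h.fderiv, hchi]

/-- The Euler operator on `Lβ` when `∂L/∂p_μ = ε_μ p_μ` for constants `ε_μ`. -/
lemma euler_fsmul_qvol_of_linear_momenta {n : ℕ} {L : Vec (2 * (n + 1) + 1) → ℝ}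
    (hL : Differentiable ℝ L) {ε : Fin (n + 1) → ℝ}
    (hε : ∀ μ, pd (pIdx μ) L = fun x => ε μ * x (pIdx μ))
    (x : Vec (2 * (n + 1) + 1)) (v : Fin (n + 1) → Vec (2 * (n + 1) + 1)) :
    euler (fsmul L qvol) x v =
      (-1) ^ (n + 1) * ∑ μ, ε μ * wedge (k := n) (betaMu μ) (dx (pIdx μ)) x v +
        pd uIdx L x * qvol x v := by
  rw [euler_fsmul_qvol hL (fun μ => by rw [hε]; fun_prop), Finset.mul_sum]
  congr 1
  refine Finset.sum_congr rfl fun μ _ => ?_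
  have hneg : -pd (pIdx μ) L = fun y => -ε μ * y (pIdx μ) := by
    rw [hε]
    funext y
    simp
  rw [hneg, dprojFun_const_mul_pIdx, covectorWedge_const_mul,
    wedge_covector_apply (betaMu μ) (dx (pIdx μ)) x (betaAlt μ) fun _ => rfl]
  have hsq : ((-1 : ℝ) ^ n) * (-1) ^ n = 1 := by rw [← mul_pow]; simp
  simp only [dx, pow_succ, Nat.add_sub_cancel]
  linear_combination ε μ * covectorWedge (fun w => w (pIdx μ)) (betaAlt μ) v * hsq

section KleinGordon

variable (m0 : ℝ)

/-- The Minkowski signature `(-, +, +, +)`. -/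
def minkowskiSign : Fin 4 → ℝ := ![-1, 1, 1, 1]

lemma lagKG_eq_sum (x : Vec (2 * 4 + 1)) :
    lagKG m0 x = (1 / 2 : ℝ) *
      (∑ μ, minkowskiSign μ * x (pIdx μ) ^ 2 + m0 ^ 2 * x (uIdx (n := 4)) ^ 2) := by
  simp [lagKG, minkowskiSign, Fin.sum_univ_four]

lemma differentiable_lagKG : Differentiable ℝ (lagKG m0) := by
  unfold lagKG
  fun_prop

lemma fderiv_lagKG (x w : Vec (2 * 4 + 1)) :
    fderiv ℝ (lagKG m0) x w =
      ∑ μ, minkowskiSign μ * x (pIdx μ) * w (pIdx μ) +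
        m0 ^ 2 * x (uIdx (n := 4)) * w (uIdx (n := 4)) := by
  have hp (i : Fin (2 * 4 + 1)) := (hasFDerivAt_apply (𝕜 := ℝ) i x).pow 2
  have h := ((HasFDerivAt.fun_sum fun μ (_ : μ ∈ Finset.univ) =>
    (hp (pIdx μ)).const_mul (minkowskiSign μ)).add
      ((hp (uIdx (n := 4))).const_mul (m0 ^ 2))).const_mul (1 / 2 : ℝ)
  rw [(h.congr_of_eventuallyEq (.of_forall (lagKG_eq_sum m0))).fderiv]
  simp [Fin.sum_univ_four]
  ring

lemma pd_pIdx_lagKG (μ : Fin 4) :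
    pd (pIdx μ) (lagKG m0) = fun x => minkowskiSign μ * x (pIdx μ) := by
  funext x
  have hp (ν : Fin 4) : basisVec (pIdx μ) (pIdx ν) = if ν = μ then (1 : ℝ) else 0 := by
    simp [basisVec, Pi.single_apply, pIdx, Fin.ext_iff]
  have hu : basisVec (pIdx μ) uIdx = (0 : ℝ) := Pi.single_eq_of_ne (pIdx_ne_uIdx μ).symm _
  simp [pd, fderiv_lagKG, hp, hu]

lemma pd_uIdx_lagKG :
    pd (uIdx (n := 4)) (lagKG m0) = fun x => m0 ^ 2 * x (uIdx (n := 4)) := by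
  funext x
  have hp (ν : Fin 4) : basisVec uIdx (pIdx ν) = (0 : ℝ) :=
    Pi.single_eq_of_ne (pIdx_ne_uIdx ν) _
  have hu : basisVec (uIdx (n := 4)) uIdx = (1 : ℝ) := Pi.single_eq_same _ _
  simp [pd, fderiv_lagKG, hp, hu]

lemma euler_lagKG :
    euler (fsmul (lagKG m0) qvol) =
      -(wedge (betaMu (0 : Fin 4)) (dx (pIdx (0 : Fin 4)))) +
        wedge (betaMu (1 : Fin 4)) (dx (pIdx (1 : Fin 4))) +
        wedge (betaMu (2 : Fin 4)) (dx (pIdx (2 : Fin 4))) +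
        wedge (betaMu (3 : Fin 4)) (dx (pIdx (3 : Fin 4))) +
        fsmul (fun x => m0 ^ 2 * x (uIdx (n := 4))) qvol := by
  funext x v
  have hE := euler_fsmul_qvol_of_linear_momenta (differentiable_lagKG m0) (pd_pIdx_lagKG m0) x v
  have hsum (f : Fin (3 + 1) → ℝ) : ∑ μ, f μ = f 0 + f 1 + f 2 + f 3 := Fin.sum_univ_four f
  rw [hsum, pd_uIdx_lagKG] at hE
  refine hE.trans ?_
  simp only [Pi.add_apply, Pi.neg_apply, fsmul]
  have h2 : minkowskiSign 2 = 1 := rfl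
  have h3 : minkowskiSign 3 = 1 := rfl
  norm_num [h2, h3]
  simp [minkowskiSign]

end KleinGordon

/-- `E(Lβ) = −β₁∧dp₁ + β₂∧dp₂ + β₃∧dp₃ + β₄∧dp₄ + m²·u·β` for the
Klein–Gordon Lagrangian `L`, hence the Klein–Gordon equation
`φ₁₁ − φ₂₂ − φ₃₃ − φ₄₄ + m²φ = 0` is the Euler–Lagrange equation of the first-order
Lagrangian `(j¹φ)*L = (1/2)(−φ₁² + φ₂² + φ₃² + φ₄² + m²φ²)`. -/
theorem klein_gordon_is_variational (m0 : ℝ) :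
    (euler (fsmul (lagKG m0) qvol) =
      -(wedge (betaMu (0 : Fin 4)) (dx (pIdx (0 : Fin 4)))) +
        wedge (betaMu (1 : Fin 4)) (dx (pIdx (1 : Fin 4))) +
        wedge (betaMu (2 : Fin 4)) (dx (pIdx (2 : Fin 4))) +
        wedge (betaMu (3 : Fin 4)) (dx (pIdx (3 : Fin 4))) +
        fsmul (fun x => m0 ^ 2 * x (uIdx (n := 4))) qvol) ∧
    (∀ φ : Vec 4 → ℝ, ContDiff ℝ (⊤ : ℕ∞) φ →
      pullback (jet φ) (euler (fsmul (lagKG m0) qvol)) =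
        fsmul (fun x => d2 φ 0 0 x - d2 φ 1 1 x - d2 φ 2 2 x - d2 φ 3 3 x +
          m0 ^ 2 * φ x) baseVol) ∧
    ∀ (φ : Vec 4 → ℝ) (x : Vec 4),
      lagKG m0 (jet φ x) =
        (1 / 2 : ℝ) * (-(fderiv ℝ φ x (basisVec 0)) ^ 2 + (fderiv ℝ φ x (basisVec 1)) ^ 2 +
          (fderiv ℝ φ x (basisVec 2)) ^ 2 + (fderiv ℝ φ x (basisVec 3)) ^ 2 +
          m0 ^ 2 * (φ x) ^ 2) := by
  refine ⟨euler_lagKG m0, fun φ hφ => ?_, fun φ x => by simp only [lagKG, jet_pIdx, jet_uIdx]⟩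
  funext x v
  have hw (μ : Fin 4) : pullback (jet φ) (wedge (k := 3) (betaMu μ) (dx (pIdx μ))) x v =
      -(d2 φ μ μ x * baseVol x v) :=
    (pullback_jet_betaMu_wedge hφ μ x v).trans (by ring)
  have hv : pullback (jet φ) (fsmul (fun y => m0 ^ 2 * y (uIdx (n := 4))) qvol) x v =
      m0 ^ 2 * φ x * baseVol x v := by
    rw [← pullback_jet_qvol hφ, ← jet_uIdx φ x]
    rfl
  have hadd (A B C D F : Form (2 * 4 + 1) 4) : pullback (jet φ) (-A + B + C + D + F) x v =
      -pullback (jet φ) A x v + pullback (jet φ) B x v + pullback (jet φ) C x v +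
        pullback (jet φ) D x v + pullback (jet φ) F x v := rfl
  rw [euler_lagKG]
  refine (hadd _ _ _ _ _).trans ?_
  rw [hw 0, hw 1, hw 2, hw 3, hv, fsmul]
  ring

end MA
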